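/- arXiv:1402.6758 — 4 statements merged into one kernel-verified Lean document; each statement's English description precedes it below -/
import Mathlib

section
/- Let K be a field of characteristic zero, let r ∈ K[x] be squarefree of degree ≥ 1 with derivative r' = dr/dx, let M ∈ M_{d×d}(K[x]), and let ℓ ≥ 1 be an integer such that the polynomial det(ℓ·r'·I − M) ∈ K[x] is coprime to r. Then for every vector w ∈ K[x]^{⊕d} there exists a unique pair of vectors (v, u) with v, u ∈ K[x]^{⊕d}, deg(v_i) < deg(r) for every component v_i of v, and w = (M − ℓ·r'·I)·v + r·(dv/dx) + r·u, where dv/dx is the componentwise derivative. -/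
open Polynomial

/-- If `det A` is coprime to `r`, then `A` acts injectively modulo `r`. -/
theorem Matrix.dvd_of_dvd_mulVec {R n : Type*} [CommRing R] [Fintype n] [DecidableEq n]
    {A : Matrix n n R} {r : R} (h : IsCoprime A.det r) {v : n → R}
    (hv : ∀ i, r ∣ A.mulVec v i) (i : n) : r ∣ v i := by
  have hadj : A.adjugate.mulVec (A.mulVec v) = A.det • v := by
    rw [Matrix.mulVec_mulVec, Matrix.adjugate_mul, Matrix.smul_mulVec, Matrix.one_mulVec]
  have hdvd : r ∣ A.det * v i := by
    have hi := congrFun hadj i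
    rw [Pi.smul_apply, smul_eq_mul] at hi
    rw [← hi]
    exact Finset.dvd_sum fun j _ => (hv j).mul_left _
  exact h.symm.dvd_of_dvd_mul_left hdvd

/-- If `det A` is coprime to `r`, then `A` acts surjectively modulo `r`. -/
theorem Matrix.exists_dvd_sub_mulVec {R n : Type*} [CommRing R] [Fintype n] [DecidableEq n]
    {A : Matrix n n R} {r : R} (h : IsCoprime A.det r) (w : n → R) :
    ∃ v : n → R, ∀ i, r ∣ w i - A.mulVec v i := by
  obtain ⟨a, b, hab⟩ := h
  refine ⟨a • A.adjugate.mulVec w, fun i => ⟨b * w i, ?_⟩⟩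
  rw [Matrix.mulVec_smul, Matrix.mulVec_mulVec, Matrix.mul_adjugate, Matrix.smul_mulVec,
    Matrix.one_mulVec]
  simp only [Pi.smul_apply, smul_eq_mul]
  linear_combination (-w i) * hab

/-- Vectors that agree modulo `r` have images under `A` that agree modulo `r`. -/
theorem Matrix.dvd_mulVec_sub_mulVec {R m n : Type*} [CommRing R] [Fintype n]
    (A : Matrix m n R) {r : R} {v v' : n → R} (h : ∀ j, r ∣ v j - v' j) (i : m) :
    r ∣ A.mulVec v i - A.mulVec v' i := by
  rw [← Pi.sub_apply, ← Matrix.mulVec_sub]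
  exact Finset.dvd_sum fun j _ => (h j).mul_left _

/-- Let `r ∈ K[x]` be squarefree of degree ≥ 1 with derivative `r'`,
`M` a `d × d` matrix over `K[x]`, and `ℓ ≥ 1` an integer such that
`det(ℓ·r'·I − M)` is coprime to `r`.  Then for every `w ∈ K[x]^d` there is a unique
pair `(v, u)` with `deg(v_i) < deg(r)` and
`w = (M − ℓ·r'·I)·v + r·(dv/dx) + r·u`. -/
theorem finite_reduction (K : Type*) [Field K] [CharZero K] (d : ℕ)
    (r : Polynomial K) (hsqf : Squarefree r) (hdeg : 1 ≤ r.natDegree)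
    (M : Matrix (Fin d) (Fin d) (Polynomial K)) (ℓ : ℕ) (hℓ : 1 ≤ ℓ)
    (hcop : IsCoprime
      (Matrix.det (((ℓ : Polynomial K) * Polynomial.derivative r) •
          (1 : Matrix (Fin d) (Fin d) (Polynomial K)) - M)) r) :
    ∀ w : Fin d → Polynomial K,
      ∃! vu : (Fin d → Polynomial K) × (Fin d → Polynomial K),
        (∀ i : Fin d, (vu.1 i).degree < r.degree) ∧
        w = (M - ((ℓ : Polynomial K) * Polynomial.derivative r) •
              (1 : Matrix (Fin d) (Fin d) (Polynomial K))).mulVec vu.1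
            + (fun i => r * Polynomial.derivative (vu.1 i))
            + (fun i => r * vu.2 i) := by
  intro w
  have hr : r ≠ 0 := hsqf.ne_zero
  set A := ((ℓ : Polynomial K) * Polynomial.derivative r) •
    (1 : Matrix (Fin d) (Fin d) (Polynomial K)) - M with hA
  have hneg : M - ((ℓ : Polynomial K) * Polynomial.derivative r) •
      (1 : Matrix (Fin d) (Fin d) (Polynomial K)) = -A := by rw [hA, neg_sub]
  rw [hneg]
  obtain ⟨v₀, hv₀⟩ := Matrix.exists_dvd_sub_mulVec hcop (-w)
  let v : Fin d → Polynomial K := fun i => v₀ i % r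
  have hv : ∀ i, r ∣ v₀ i - v i := fun i =>
    ⟨v₀ i / r, by linear_combination -EuclideanDomain.div_add_mod (v₀ i) r⟩
  have hw : ∀ i, r ∣ w i + A.mulVec v i := fun i => by
    have h := (hv₀ i).add (A.dvd_mulVec_sub_mulVec hv i)
    rw [sub_add_sub_cancel, Pi.neg_apply, ← neg_add', dvd_neg] at h
    exact h
  choose q hq using hw
  refine ⟨(v, fun i => q i - derivative (v i)), ⟨fun i => EuclideanDomain.mod_lt _ hr, ?_⟩, ?_⟩
  · ext1 i
    simp only [Matrix.neg_mulVec, Pi.add_apply, Pi.neg_apply]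
    linear_combination hq i
  · rintro ⟨v', u'⟩ ⟨hdeg', hw'⟩
    have heq : ∀ i, w i + A.mulVec v' i = r * (derivative (v' i) + u' i) := fun i => by
      have h := congrFun hw' i
      simp only [Matrix.neg_mulVec, Pi.add_apply, Pi.neg_apply] at h
      linear_combination h
    have hvv : v' = v := by
      ext1 i
      have hdvd : r ∣ (v' - v) i := Matrix.dvd_of_dvd_mulVec hcop (fun j => by
        rw [Matrix.mulVec_sub, Pi.sub_apply]
        exact ⟨derivative (v' j) + u' j - q j, by linear_combination heq j - hq j⟩) i
      refine sub_eq_zero.mp (eq_zero_of_dvd_of_degree_lt hdvd ?_)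
      exact (degree_sub_le _ _).trans_lt
        (max_lt (hdeg' i) (EuclideanDomain.mod_lt (v₀ i) hr))
    subst hvv
    refine Prod.ext rfl (funext fun i => mul_left_cancel₀ hr ?_)
    linear_combination hq i - heq i
end

section
/- Let p be a prime and let m ≥ 1 be an integer. Let (a_i)_{−m ≤ i ≤ −1} be elements of ℚ_p such that i·a_i ∈ ℤ_p for every integer i with −m ≤ i ≤ −1. Then p^{⌊log_p m⌋}·a_i ∈ ℤ_p for every integer i with −m ≤ i ≤ −1. -/
/-- A nonzero integer of absolute value at most `m` has `p`-adic norm at least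
`‖p ^ ⌊log_p m⌋‖`. -/
theorem Padic.norm_p_pow_log_le_norm_intCast {p : ℕ} [Fact p.Prime] {m : ℕ} {k : ℤ}
    (hk : k ≠ 0) (hkm : k.natAbs ≤ m) :
    ‖(p : ℚ_[p]) ^ Nat.log p m‖ ≤ ‖(k : ℚ_[p])‖ := by
  have hp : (1 : ℝ) ≤ p := mod_cast (Fact.out : p.Prime).one_le
  have hval : padicValInt p k ≤ Nat.log p m :=
    (padicValNat_le_nat_log k.natAbs).trans (Nat.log_mono_right hkm)
  rw [Padic.norm_p_pow, Padic.norm_eq_zpow_neg_valuation (Int.cast_ne_zero.mpr hk),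
    Padic.valuation_intCast]
  exact zpow_le_zpow_right₀ hp (neg_le_neg (mod_cast hval))

/-- If `a_i ∈ ℚ_p` for `−m ≤ i ≤ −1` satisfy `i·a_i ∈ ℤ_p`, then
`p^⌊log_p m⌋·a_i ∈ ℤ_p` for all `−m ≤ i ≤ −1`.  (Membership in `ℤ_p ⊆ ℚ_p` is
expressed by the norm being at most `1`.) -/
theorem integration_precision_loss (p : ℕ) [Fact p.Prime] (m : ℕ) (hm : 1 ≤ m)
    (a : ℤ → ℚ_[p])
    (ha : ∀ i : ℤ, -(m : ℤ) ≤ i → i ≤ -1 → ‖(i : ℚ_[p]) * a i‖ ≤ 1) :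
    ∀ i : ℤ, -(m : ℤ) ≤ i → i ≤ -1 →
      ‖(p : ℚ_[p]) ^ (Nat.log p m) * a i‖ ≤ 1 := by
  intro i him hi
  refine le_trans ?_ (ha i him hi)
  rw [norm_mul, norm_mul]
  gcongr
  exact Padic.norm_p_pow_log_le_norm_intCast (by omega) (by omega)
end

section
/- Let p be a prime number. Let Q ∈ ℤ_p[X,Y] be monic in Y of degree d ≥ 1 (as a polynomial in Y with coefficients in ℤ_p[X]), let r ∈ ℤ_p[X] be nonzero, and suppose there exists s ∈ ℤ_p[X,Y] such that s·(∂Q/∂Y) − r lies in the ideal of ℤ_p[X,Y] generated by Q. Let A₀ = ℤ_p[X,Y,Z]/(Q, Z·r − 1) and let A be the p-adic completion of A₀ (the completion of A₀ with respect to the ideal (p); A₀ is Noetherian, so A is p-adically complete). Then there exists a ring homomorphism F : A → A such that F(X) = X^p and F(a) − a^p ∈ p·A for every a ∈ A. -/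
set_option maxSynthPendingDepth 3

open Polynomial

/-- The coordinate ring `A₀ = ℤ_p[X,Y,Z]/(Q, Z·r − 1)`, realised with `X` the
innermost variable, `Y` the middle one and `Z` the outer one, so that
`Q ∈ ℤ_p[X][Y]` is embedded via the constant map in `Z`, and `Z·r − 1` is
`X_outer · C (C r) − 1`. -/
abbrev curveRing (p : ℕ) [Fact p.Prime]
    (Q : Polynomial (Polynomial ℤ_[p])) (r : Polynomial ℤ_[p]) : Type :=
  Polynomial (Polynomial (Polynomial ℤ_[p])) ⧸
    (Ideal.span ({Polynomial.C Q,
        Polynomial.X * Polynomial.C (Polynomial.C r) - 1} :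
        Set (Polynomial (Polynomial (Polynomial ℤ_[p])))))

/-- The `p`-adic completion `A` of `A₀`. -/
abbrev curveRingCompletion (p : ℕ) [Fact p.Prime]
    (Q : Polynomial (Polynomial ℤ_[p])) (r : Polynomial ℤ_[p]) : Type :=
  AdicCompletion (Ideal.span {(p : curveRing p Q r)}) (curveRing p Q r)

/-- A ring homomorphism from `R` to a `J`-adically complete ring that maps `I` into `J` extends to
the `I`-adic completion of `R`. -/
theorem AdicCompletion.exists_ringHom_extension {R S : Type*} [CommRing R] [CommRing S]
    (I : Ideal R) (J : Ideal S) [IsAdicComplete J S] (f : R →+* S) (hf : I ≤ J.comap f) :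
    ∃ F : AdicCompletion I R →+* S, ∀ x, F (algebraMap R (AdicCompletion I R) x) = f x := by
  have hpow (n : ℕ) : I ^ n ≤ (J ^ n).comap f :=
    (Ideal.pow_right_mono hf n).trans (Ideal.le_comap_pow f n)
  let g (n : ℕ) : AdicCompletion I R →+* S ⧸ J ^ n :=
    (Ideal.quotientMap (J ^ n) f (hpow n)).comp (AdicCompletion.evalₐ I n).toRingHom
  have hg {m n : ℕ} (hle : m ≤ n) : (Ideal.Quotient.factorPow J hle).comp (g n) = g m := by
    ext x
    obtain ⟨x, rfl⟩ := AdicCompletion.mk_surjective I R x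
    simp only [g, RingHom.comp_apply, AlgHom.toRingHom_eq_coe, RingHom.coe_coe,
      AdicCompletion.evalₐ_mk, Ideal.quotientMap_mk]
    refine (Ideal.Quotient.factor_mk _ _).trans ?_
    rw [Ideal.Quotient.mk_eq_mk_iff_sub_mem, ← map_sub]
    refine hpow m ?_
    simpa using (Submodule.Quotient.eq _).1 (AdicCompletion.AdicCauchySequence.mk_eq_mk hle x)
  refine ⟨IsAdicComplete.liftRingHom J g hg, fun x ↦ ?_⟩
  refine (IsHausdorff.eq_iff_smodEq (I := J)).2 fun n ↦ ?_
  rw [smul_eq_mul, Ideal.mul_top, SModEq.sub_mem, ← Ideal.Quotient.mk_eq_mk_iff_sub_mem,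
    IsAdicComplete.mk_liftRingHom]
  simp [g]

/-- In a commutative ring in which the prime `p` vanishes, `x ↦ x ^ p` is a ring homomorphism;
the zero ring is allowed. -/
theorem exists_ringHom_eq_pow (p : ℕ) [hp : Fact p.Prime] (B : Type*) [CommRing B]
    (h : (p : B) = 0) : ∃ φ : B →+* B, ∀ x, φ x = x ^ p := by
  rcases subsingleton_or_nontrivial B with _ | _
  · exact ⟨RingHom.id B, fun x ↦ Subsingleton.elim _ _⟩
  · have : CharP B p := (CharP.charP_iff_prime_eq_zero hp.out).2 h
    exact ⟨frobenius B p, fun x ↦ rfl⟩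

theorem PadicInt.map_pow_eq_of_natCast_eq_zero {p : ℕ} [hp : Fact p.Prime] {B : Type*} [CommRing B]
    (f : ℤ_[p] →+* B) (h : (p : B) = 0) (c : ℤ_[p]) : f c ^ p = f c := by
  have hc : c ^ p - c ∈ RingHom.ker (PadicInt.toZMod : ℤ_[p] →+* ZMod p) := by
    simp [RingHom.mem_ker]
  rw [PadicInt.ker_toZMod, PadicInt.maximalIdeal_eq_span_p, Ideal.mem_span_singleton] at hc
  obtain ⟨b, hb⟩ := hc
  have := congrArg f hb
  rwa [map_mul, map_natCast, h, zero_mul, map_sub, map_pow, sub_eq_zero] at this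

/-- Evaluation of bivariate polynomials over `ℤ_[p]` at a point of `A × A`. -/
noncomputable abbrev bivariateEval {p : ℕ} [Fact p.Prime] {A : Type*} [CommRing A]
    [Algebra ℤ_[p] A] (x y : A) : ℤ_[p][X][X] →+* A :=
  eval₂RingHom (eval₂RingHom (algebraMap ℤ_[p] A) x) y

/-- Evaluation at a `p`-th power is the `p`-th power of the evaluation, modulo `p`. -/
theorem map_bivariateEval_pow {p : ℕ} [Fact p.Prime] {A B : Type*} [CommRing A] [Algebra ℤ_[p] A]
    [CommRing B] (h : (p : B) = 0) (π : A →+* B) (x y : A) (g : ℤ_[p][X][X]) :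
    π (bivariateEval (x ^ p) (y ^ p) g) = π (bivariateEval x y g) ^ p := by
  obtain ⟨φ, hφ⟩ := exists_ringHom_eq_pow p B h
  rw [← hφ]
  suffices π.comp (bivariateEval (x ^ p) (y ^ p)) = φ.comp (π.comp (bivariateEval x y)) from
    RingHom.congr_fun this g
  refine Polynomial.ringHom_ext' (Polynomial.ringHom_ext (fun c ↦ ?_) ?_) ?_
  · simpa [hφ] using
      (PadicInt.map_pow_eq_of_natCast_eq_zero (π.comp (algebraMap ℤ_[p] A)) h c).symm
  · simp [hφ]
  · simp [hφ]

/-- Hensel's lemma lifts the `p`-th power of a point `(x, y)` of the curve `Q = 0` at which `r` is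
invertible to a point of the curve with first coordinate `x ^ p`. -/
theorem exists_lift_frobenius_point {p : ℕ} [Fact p.Prime] {A : Type*} [CommRing A]
    [Algebra ℤ_[p] A] [IsAdicComplete (Ideal.span {(p : A)}) A]
    {Q s : ℤ_[p][X][X]} {r : ℤ_[p][X]} (hQ : Q.Monic) {x y z : A}
    (hxy : bivariateEval x y Q = 0) (hz : z * bivariateEval x y (C r) = 1)
    (hs : bivariateEval x y (s * derivative Q) = bivariateEval x y (C r)) :
    ∃ β ζ : A, bivariateEval (x ^ p) β Q = 0 ∧ ζ * bivariateEval (x ^ p) β (C r) = 1 ∧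
      Ideal.Quotient.mk (Ideal.span {(p : A)}) β = Ideal.Quotient.mk _ y ^ p ∧
      Ideal.Quotient.mk (Ideal.span {(p : A)}) ζ = Ideal.Quotient.mk _ z ^ p := by
  set J := Ideal.span {(p : A)}
  set π := Ideal.Quotient.mk J
  have hp0 : (p : A ⧸ J) = 0 := by
    rw [← map_natCast π]
    exact Ideal.Quotient.eq_zero_iff_mem.2 (Ideal.mem_span_singleton_self _)
  have hπz : π z ^ p * π (bivariateEval (x ^ p) (y ^ p) (C r)) = 1 := by
    rw [map_bivariateEval_pow hp0, ← mul_pow, ← map_mul, hz, map_one, one_pow]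
  have hroot : (Q.map (eval₂RingHom (algebraMap ℤ_[p] A) (x ^ p))).eval (y ^ p) ∈ J := by
    rw [eval_map, ← Ideal.Quotient.eq_zero_iff_mem]
    refine (map_bivariateEval_pow hp0 π x y Q).trans ?_
    rw [hxy, map_zero, zero_pow (Fact.out : p.Prime).ne_zero]
  have hder : IsUnit (π ((Q.map (eval₂RingHom (algebraMap ℤ_[p] A) (x ^ p))).derivative.eval
      (y ^ p))) := by
    rw [derivative_map, eval_map]
    refine IsUnit.of_mul_eq_one (π (z * bivariateEval x y s) ^ p) ?_
    refine (congrArg (· * _) (map_bivariateEval_pow hp0 π x y (derivative Q))).trans ?_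
    rw [map_mul] at hs
    rw [← mul_pow, ← map_mul, mul_comm, mul_assoc, hs, hz, map_one, one_pow]
  obtain ⟨β, hβ, hβy⟩ := HenselianRing.is_henselian (I := J) _ (hQ.map _) _ hroot hder
  have hunit : IsUnit (z ^ p * bivariateEval (x ^ p) (y ^ p) (C r)) := by
    refine Ideal.isUnit_of_sub_one_mem_jacobson_bot _ (IsAdicComplete.le_jacobson_bot J ?_)
    rw [← Ideal.Quotient.eq_zero_iff_mem, map_sub, map_mul, map_pow, hπz, map_one, sub_self]
  obtain ⟨ζ, hζ⟩ := (isUnit_of_mul_isUnit_right hunit).exists_left_inv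
  have hC : bivariateEval (x ^ p) β (C r) = bivariateEval (x ^ p) (y ^ p) (C r) := by simp
  refine ⟨β, ζ, by simpa [IsRoot.def, eval_map] using hβ, hC ▸ hζ, ?_, ?_⟩
  · rw [← map_pow]
    exact Ideal.Quotient.mk_eq_mk_iff_sub_mem _ _ |>.2 hβy
  · have h1 : π ζ * π (bivariateEval (x ^ p) (y ^ p) (C r)) = 1 := by
      rw [← map_mul, hζ, map_one]
    rw [mul_comm] at hπz
    exact left_inv_eq_right_inv h1 hπz

/-- Let `Q ∈ ℤ_p[X,Y]` be monic in `Y` of degree `d ≥ 1`, `r ∈ ℤ_p[X]`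
nonzero, and suppose `s·(∂Q/∂Y) ≡ r mod (Q)` for some `s ∈ ℤ_p[X,Y]`.  Then on the
`p`-adic completion `A` of `A₀ = ℤ_p[X,Y,Z]/(Q, Z·r − 1)` there is a ring
endomorphism `F` with `F(X) = X^p` which lifts the `p`-power Frobenius, i.e.
`F(a) − a^p ∈ p·A` for all `a ∈ A`. -/
theorem frobenius_lift_exists (p : ℕ) [Fact p.Prime]
    (Q : Polynomial (Polynomial ℤ_[p])) (d : ℕ) (hd : 1 ≤ d)
    (hmonic : Q.Monic) (hdeg : Q.natDegree = d)
    (r : Polynomial ℤ_[p]) (hr : r ≠ 0)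
    (s : Polynomial (Polynomial ℤ_[p]))
    (hs : s * Polynomial.derivative Q - Polynomial.C r ∈ Ideal.span {Q}) :
    ∃ F : curveRingCompletion p Q r →+* curveRingCompletion p Q r,
      F (algebraMap (curveRing p Q r) (curveRingCompletion p Q r)
          (Ideal.Quotient.mk _ (Polynomial.C (Polynomial.C (Polynomial.X))))) =
        (algebraMap (curveRing p Q r) (curveRingCompletion p Q r)
          (Ideal.Quotient.mk _ (Polynomial.C (Polynomial.C (Polynomial.X))))) ^ p ∧
      ∀ a : curveRingCompletion p Q r,
        F a - a ^ p ∈ Ideal.span {(p : curveRingCompletion p Q r)} := by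
  set A := curveRingCompletion p Q r
  set ι := algebraMap (curveRing p Q r) A
  set J : Ideal A := Ideal.span {(p : A)}
  have hfg : (Ideal.span {(p : curveRing p Q r)}).FG := ⟨{(p : curveRing p Q r)}, by simp⟩
  have hmap : (Ideal.span {(p : curveRing p Q r)}).map ι = J := by
    rw [Ideal.map_span, Set.image_singleton, map_natCast]
  have : IsAdicComplete J A := by
    rw [← hmap]
    exact (IsAdicComplete.map_algebraMap_iff _ _).2 (AdicCompletion.isAdicComplete hfg)
  set mk := Ideal.Quotient.mk (Ideal.span ({C Q, X * C (C r) - 1} : Set ℤ_[p][X][X][X]))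
  set x := ι (mk (C (C X)))
  set y := ι (mk (C X))
  set z := ι (mk X)
  have heval : bivariateEval x y = (ι.comp mk).comp C := by
    refine Polynomial.ringHom_ext' (Polynomial.ringHom_ext (fun c ↦ ?_) ?_) ?_
    · simp only [bivariateEval, RingHom.comp_apply, coe_eval₂RingHom, eval₂_C]
      rfl
    · simp [x]
    · simp [y]
  have hQ0 : mk (C Q) = 0 := Ideal.Quotient.eq_zero_iff_mem.2 (Ideal.subset_span (by simp))
  have hr0 : mk (X * C (C r) - 1) = 0 :=
    Ideal.Quotient.eq_zero_iff_mem.2 (Ideal.subset_span (by simp))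
  have hxy : bivariateEval x y Q = 0 := by simp [heval, hQ0]
  have hz : z * bivariateEval x y (C r) = 1 := by
    rw [map_sub, map_one, sub_eq_zero] at hr0
    rw [heval]
    simp only [z, RingHom.comp_apply]
    rw [← map_mul, ← map_mul, hr0, map_one]
  have hsr : bivariateEval x y (s * derivative Q) = bivariateEval x y (C r) := by
    obtain ⟨t, ht⟩ := Ideal.mem_span_singleton.1 hs
    rw [← sub_eq_zero, ← map_sub, ht, map_mul, hxy, zero_mul]
  obtain ⟨β, ζ, hβ, hζ, hβy, hζz⟩ := exists_lift_frobenius_point hmonic hxy hz hsr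
  set π := Ideal.Quotient.mk J
  have hp0 : (p : A ⧸ J) = 0 := by
    rw [← map_natCast π]
    exact Ideal.Quotient.eq_zero_iff_mem.2 (Ideal.mem_span_singleton_self _)
  obtain ⟨φ, hφ⟩ := exists_ringHom_eq_pow p (A ⧸ J) hp0
  let f : curveRing p Q r →+* A :=
    Ideal.Quotient.lift _ (eval₂RingHom (bivariateEval (x ^ p) β) ζ) <| by
      intro a ha
      rw [← RingHom.mem_ker]
      refine Ideal.span_le.2 ?_ ha
      rintro _ (rfl | rfl)
      · simpa [RingHom.mem_ker] using hβ
      · rw [SetLike.mem_coe, RingHom.mem_ker, map_sub, map_mul, map_one, sub_eq_zero]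
        simpa using hζ
  have hfmk (g) : f (mk g) = eval₂RingHom (bivariateEval (x ^ p) β) ζ g :=
    Ideal.Quotient.lift_mk _ _ _
  have hfφ : π.comp f = φ.comp (π.comp ι) := by
    refine Ideal.Quotient.ringHom_ext (Polynomial.ringHom_ext'
      (Polynomial.ringHom_ext' (Polynomial.ringHom_ext (fun c ↦ ?_) ?_) ?_) ?_)
    · have hc : ι (mk (C (C (C c)))) = algebraMap ℤ_[p] A c := rfl
      change π (f (mk (C (C (C c))))) = φ (π (ι (mk (C (C (C c))))))
      rw [hfmk, hφ, hc]
      simpa using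
        (PadicInt.map_pow_eq_of_natCast_eq_zero (π.comp (algebraMap ℤ_[p] A)) hp0 c).symm
    · change π (f (mk (C (C X)))) = φ (π x)
      simp [hfmk, hφ]
    · change π (f (mk (C X))) = φ (π y)
      simpa [hfmk, hφ] using hβy
    · change π (f (mk X)) = φ (π z)
      simpa [hfmk, hφ] using hζz
  obtain ⟨F, hF⟩ := AdicCompletion.exists_ringHom_extension
    (Ideal.span {(p : curveRing p Q r)}) J f <| by
      rw [Ideal.span_singleton_le_iff_mem, Ideal.mem_comap, map_natCast]
      exact Ideal.mem_span_singleton_self _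
  refine ⟨F, ?_, fun a ↦ ?_⟩
  · rw [hF, hfmk]
    simp
  · obtain ⟨a₀, ha₀⟩ := Ideal.Quotient.mk_surjective (AdicCompletion.evalOneₐ _ a)
    have ha : a - ι a₀ ∈ J := by
      rw [← hmap, ← AdicCompletion.ker_evalOneₐ_eq_map _ hfg, RingHom.mem_ker, map_sub, sub_eq_zero]
      exact ha₀.symm
    have hFa : F (a - ι a₀) ∈ J := by
      obtain ⟨b, hb⟩ := Ideal.mem_span_singleton.1 ha
      rw [hb, map_mul, map_natCast]
      exact Ideal.mul_mem_right _ _ (Ideal.mem_span_singleton_self _)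
    rw [map_sub, hF] at hFa
    rw [← Ideal.Quotient.mk_eq_mk_iff_sub_mem] at ha hFa ⊢
    rw [hFa, map_pow, ← hφ, ha]
    exact RingHom.congr_fun hfφ a₀
end

section
/- Let p be a prime, N ≥ 1 an integer, and let r ∈ ℤ_p[x] be a polynomial of degree ≥ 1 whose leading coefficient is a unit in ℤ_p. Then there exist polynomials ρ_p, ρ_{p+1}, …, ρ_{pN} ∈ ℤ_p[x], each of degree strictly less than deg(r), such that r(x^p)·(Σ_{i=p}^{pN} ρ_i·r^{pN−i}) ≡ r^{pN} modulo p^N·ℤ_p[x]. -/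
open Polynomial Finset

/-- Expansion of a polynomial of degree at most `m * deg r` in powers of a polynomial `r` with unit
leading coefficient. -/
theorem exists_eq_sum_mul_pow_of_isUnit_leadingCoeff {R : Type*} [CommRing R] [Nontrivial R]
    {r : R[X]} (hdeg : 1 ≤ r.natDegree) (hlead : IsUnit r.leadingCoeff) (m : ℕ) :
    ∀ f : R[X], f.natDegree ≤ m * r.natDegree →
      ∃ a : ℕ → R[X], (∀ j, (a j).degree < r.degree) ∧
        f = ∑ j ∈ Finset.range (m + 1), a j * r ^ j := by
  induction m with
  | zero =>
    intro f hf
    exact ⟨fun _ => f, fun _ => degree_lt_degree (show f.natDegree < r.natDegree by omega), by simp⟩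
  | succ m ih =>
    intro f hf
    obtain ⟨u, hu⟩ := hlead
    set g : R[X] := C (↑u⁻¹ : R) * r with hg
    have hmonic : g.Monic := monic_C_mul_of_mul_leadingCoeff_eq_one (by rw [← hu]; simp)
    have hgr : r = C (u : R) * g := by rw [hg, ← mul_assoc, ← C_mul]; simp
    have hdegree : g.degree = r.degree := by
      conv_rhs => rw [hgr]
      rw [degree_C_mul_of_isUnit u.isUnit]
    have hnat : g.natDegree = r.natDegree := natDegree_eq_of_degree_eq hdegree
    obtain ⟨a, ha, hsum⟩ := ih (C (↑u⁻¹ : R) * (f /ₘ g)) (by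
      refine (natDegree_C_mul_le _ _).trans ?_
      rw [natDegree_divByMonic f hmonic, hnat]
      rw [add_mul] at hf
      omega)
    refine ⟨fun j => Nat.casesOn j (f %ₘ g) a, ?_, ?_⟩
    · rintro (_ | j)
      · exact hdegree ▸ degree_modByMonic_lt f hmonic
      · exact ha j
    · rw [Finset.sum_range_succ']
      simp only [pow_zero, mul_one, pow_succ, ← mul_assoc]
      rw [← Finset.sum_mul, ← hsum]
      conv_lhs => rw [← modByMonic_add_div f g]
      change _ = _ + f %ₘ g
      linear_combination (f /ₘ g) * hg

/-- The lift `x ↦ x ^ p` of Frobenius on `ℤ_[p][X]` agrees with the `p`-th power modulo `p`. -/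
theorem PadicInt.natCast_dvd_pow_sub_comp_X_pow (p : ℕ) [Fact p.Prime] (r : ℤ_[p][X]) :
    (p : ℤ_[p][X]) ∣ r ^ p - r.comp (X ^ p) := by
  rw [← C_eq_natCast, C_dvd_iff_dvd_coeff]
  intro i
  rw [← Ideal.mem_span_singleton, ← PadicInt.maximalIdeal_eq_span_p, ← PadicInt.ker_toZMod,
    RingHom.mem_ker, ← coeff_map, ← expand_eq_comp_X_pow, Polynomial.map_sub, map_expand,
    ZMod.expand_card, Polynomial.map_pow, sub_self, coeff_zero]

/-- For `r ∈ ℤ_p[x]` of degree ≥ 1 with unit leading coefficient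
and `N ≥ 1`, there are polynomials `ρ_p, …, ρ_{pN}` of degree `< deg r` with
`r(x^p)·(∑_{i=p}^{pN} ρ_i·r^{pN−i}) ≡ r^{pN} mod p^N`.  (This is the congruence
`Frob_p(1/r) ≡ ∑_{i=p}^{pN} ρ_i/r^i mod p^N` with denominators cleared.) -/
theorem frobenius_inverse_r_expansion (p : ℕ) [Fact p.Prime] (N : ℕ) (hN : 1 ≤ N)
    (r : Polynomial ℤ_[p]) (hdeg : 1 ≤ r.natDegree)
    (hlead : IsUnit r.leadingCoeff) :
    ∃ ρ : ℕ → Polynomial ℤ_[p],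
      (∀ i : ℕ, (ρ i).degree < r.degree) ∧
      r.comp (Polynomial.X ^ p) *
          (∑ i ∈ Finset.Icc p (p * N), ρ i * r ^ (p * N - i)) - r ^ (p * N) ∈
        Ideal.span {(p : Polynomial ℤ_[p]) ^ N} := by
  obtain ⟨M, rfl⟩ : ∃ M, N = M + 1 := ⟨N - 1, by omega⟩
  set d := r ^ p - r.comp (X ^ p) with hd
  have hpow : (r ^ p).natDegree ≤ p * r.natDegree := natDegree_pow_le
  have hddeg : d.natDegree ≤ p * r.natDegree := by
    refine natDegree_sub_le_of_le hpow ?_ |>.trans (max_self _).le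
    rw [natDegree_comp, natDegree_X_pow, mul_comm]
  obtain ⟨a, ha, hsum⟩ := exists_eq_sum_mul_pow_of_isUnit_leadingCoeff hdeg hlead (p * M)
    (∑ i ∈ Finset.range (M + 1), d ^ i * (r ^ p) ^ (M + 1 - 1 - i)) (by
      refine natDegree_sum_le_of_forall_le _ _ fun i hi => ?_
      have hi : i ≤ M := Nat.lt_succ_iff.mp (Finset.mem_range.mp hi)
      refine (natDegree_mul_le_of_le (natDegree_pow_le_of_le i hddeg)
        (natDegree_pow_le_of_le _ hpow)).trans ?_
      rw [← add_mul, Nat.add_sub_cancel, Nat.add_sub_cancel' hi]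
      exact le_of_eq (by ring))
  refine ⟨fun i => a (p * (M + 1) - i), fun i => ha _, ?_⟩
  have hreindex : ∑ i ∈ Finset.Icc p (p * (M + 1)), a (p * (M + 1) - i) * r ^ (p * (M + 1) - i) =
      ∑ j ∈ Finset.range (p * M + 1), a j * r ^ j := by
    rw [mul_add, mul_one]
    refine Finset.sum_nbij' (fun i => p * M + p - i) (fun j => p * M + p - j) ?_ ?_ ?_ ?_
      (fun _ _ => rfl) <;>
      simp only [Finset.mem_Icc, Finset.mem_range] <;> intros <;> omega
  have hcomp : r.comp (X ^ p) = r ^ p - d := by rw [hd]; ring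
  have hgeom := (Commute.all d (r ^ p)).geom_sum₂_mul (M + 1)
  rw [hreindex, ← hsum, Ideal.mem_span_singleton, hcomp]
  have hdiff : (r ^ p - d) * (∑ i ∈ Finset.range (M + 1), d ^ i * (r ^ p) ^ (M + 1 - 1 - i)) -
      r ^ (p * (M + 1)) = -d ^ (M + 1) := by
    rw [pow_mul]
    linear_combination -hgeom
  rw [hdiff, dvd_neg]
  exact pow_dvd_pow_of_dvd (PadicInt.natCast_dvd_pow_sub_comp_X_pow p r) _
end
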